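/- Let U ∈ ℝ^{M×N}, let Φ : ℝ^{M×N} → ℝ^{M×N}, let c > 0, 0 < q < 1, and let R ≥ 2 be an integer. Suppose there exists U₀ ∈ ℝ^{M×N} with rank(U₀) ≤ 1 such that the iterates U_{n+1} = Φ(U_n) satisfy ‖U_n − U‖_F ≤ c·q^n·‖U₀ − U‖_F and rank(U_{n+1}) ≤ R·rank(U_n) for all n ≥ 0. Then for every integer r ≥ 1 one has τ_r(U) ≤ c·‖U₀ − U‖_F · q^{⌊log_R r⌋} ≤ c·‖U₀ − U‖_F · q^{−1} · (1/r)^{ln(1/q)/ln R}. -/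

import Mathlib

/-- Frobenius inner product of real matrices. -/
noncomputable def frobInner {M N : ℕ} (X Y : Matrix (Fin M) (Fin N) ℝ) : ℝ :=
  ∑ i, ∑ j, X i j * Y i j

/-- Frobenius norm of a real matrix. -/
noncomputable def frobNorm {M N : ℕ} (X : Matrix (Fin M) (Fin N) ℝ) : ℝ :=
  Real.sqrt (frobInner X X)

/-- Best rank-`r` approximation error in the Frobenius norm. -/
noncomputable def tau {M N : ℕ} (r : ℕ) (U : Matrix (Fin M) (Fin N) ℝ) : ℝ :=
  sInf {x : ℝ | ∃ V : Matrix (Fin M) (Fin N) ℝ, V.rank ≤ r ∧ x = frobNorm (U - V)}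

lemma frobNorm_nonneg {M N : ℕ} (X : Matrix (Fin M) (Fin N) ℝ) : 0 ≤ frobNorm X :=
  Real.sqrt_nonneg _

lemma frobNorm_sub_comm {M N : ℕ} (X Y : Matrix (Fin M) (Fin N) ℝ) :
    frobNorm (X - Y) = frobNorm (Y - X) := by
  unfold frobNorm frobInner
  congr 1
  refine Finset.sum_congr rfl fun i _ => Finset.sum_congr rfl fun j _ => ?_
  simp only [Matrix.sub_apply]
  ring

lemma tau_le_frobNorm_sub {M N r : ℕ} (U : Matrix (Fin M) (Fin N) ℝ)
    {V : Matrix (Fin M) (Fin N) ℝ} (hV : V.rank ≤ r) : tau r U ≤ frobNorm (U - V) := by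
  refine csInf_le ⟨0, ?_⟩ ⟨V, hV, rfl⟩
  rintro x ⟨W, -, rfl⟩
  exact frobNorm_nonneg _

lemma rank_le_pow_of_rank_growth {M N R : ℕ} {u : ℕ → Matrix (Fin M) (Fin N) ℝ}
    (h₀ : (u 0).rank ≤ 1) (hgrowth : ∀ n, (u (n + 1)).rank ≤ R * (u n).rank) (n : ℕ) :
    (u n).rank ≤ R ^ n := by
  induction n with
  | zero => simpa using h₀
  | succ n ih =>
    rw [pow_succ']
    exact (hgrowth n).trans (Nat.mul_le_mul_left R ih)

lemma pow_natLog_le_inv_mul_rpow {q : ℝ} (hq0 : 0 < q) (hq1 : q < 1) {R r : ℕ} (hR : 2 ≤ R)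
    (hr : 1 ≤ r) :
    q ^ Nat.log R r ≤ q⁻¹ * ((1 : ℝ) / r) ^ (Real.log (1 / q) / Real.log R) := by
  have hr0 : (0 : ℝ) < r := by exact_mod_cast hr
  have hlogR : 0 < Real.log R := Real.log_pos (by exact_mod_cast hR)
  have hlog : Real.log r / Real.log R ≤ (Nat.log R r + 1 : ℕ) := by
    rw [div_le_iff₀ hlogR, ← Real.log_pow]
    refine Real.log_le_log hr0 ?_
    exact_mod_cast (Nat.lt_pow_succ_log_self hR r).le
  have hexp : ((1 : ℝ) / r) ^ (Real.log (1 / q) / Real.log R) =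
      q ^ (Real.log r / Real.log R) := by
    rw [Real.rpow_def_of_pos (by positivity), Real.rpow_def_of_pos hq0]
    simp only [one_div, Real.log_inv]
    congr 1
    ring
  rw [hexp, le_inv_mul_iff₀ hq0, ← pow_succ', ← Real.rpow_natCast]
  exact Real.rpow_le_rpow_of_exponent_ge hq0 hq1.le hlog

/-- simplified algebraic decay bounds for the best rank-`r`
approximation error obtained from a contractive fixed-point iteration with
finite rank growth. -/
theorem tau_simplified_bounds_of_fixed_point_iteration
    {M N : ℕ} (U : Matrix (Fin M) (Fin N) ℝ)
    (Φ : Matrix (Fin M) (Fin N) ℝ → Matrix (Fin M) (Fin N) ℝ)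
    (c q : ℝ) (hc : 0 < c) (hq0 : 0 < q) (hq1 : q < 1)
    (R : ℕ) (hR : 2 ≤ R)
    (U₀ : Matrix (Fin M) (Fin N) ℝ) (hrank₀ : U₀.rank ≤ 1)
    (u : ℕ → Matrix (Fin M) (Fin N) ℝ)
    (hu0 : u 0 = U₀)
    (hiter : ∀ n : ℕ, u (n + 1) = Φ (u n))
    (hcontr : ∀ n : ℕ, frobNorm (u n - U) ≤ c * q ^ n * frobNorm (U₀ - U))
    (hgrowth : ∀ n : ℕ, (u (n + 1)).rank ≤ R * (u n).rank)
    (r : ℕ) (hr : 1 ≤ r) :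
    tau r U ≤ c * frobNorm (U₀ - U) * q ^ Nat.log R r ∧
    c * frobNorm (U₀ - U) * q ^ Nat.log R r ≤
      c * frobNorm (U₀ - U) * q⁻¹ *
        ((1 : ℝ) / r) ^ (Real.log (1 / q) / Real.log R) := by
  constructor
  · have hrank : (u (Nat.log R r)).rank ≤ r :=
      (rank_le_pow_of_rank_growth (hu0 ▸ hrank₀) hgrowth _).trans
        (Nat.pow_log_le_self R (by lia))
    calc tau r U ≤ frobNorm (U - u (Nat.log R r)) := tau_le_frobNorm_sub U hrank
      _ = frobNorm (u (Nat.log R r) - U) := frobNorm_sub_comm _ _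
      _ ≤ c * q ^ Nat.log R r * frobNorm (U₀ - U) := hcontr _
      _ = c * frobNorm (U₀ - U) * q ^ Nat.log R r := by ring
  · rw [mul_assoc _ q⁻¹]
    exact mul_le_mul_of_nonneg_left (pow_natLog_le_inv_mul_rpow hq0 hq1 hR hr)
      (mul_nonneg hc.le (frobNorm_nonneg _))
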